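/- Let 1 < α < 2. Then for all real numbers u and v: (u+v)^{<α−1>} − u^{<α−1>} − v^{<α−1>} = −(4/(Γ(1−α)·cos(απ/2))) · ∫_0^{+∞} sin(ut/2) · sin(vt/2) · sin((u+v)t/2) / t^α dt, where the integrand is integrable on (0,∞). -/

import Mathlib

open MeasureTheory Real

/-- Signed power: `s^{<β>} = sign(s) * |s|^β`. -/
noncomputable def spow (s β : ℝ) : ℝ := Real.sign s * |s| ^ β

lemma aux_sin_int (α c : ℝ) (hα1 : 1 < α) (hα2 : α < 2) :
    IntegrableOn (fun t : ℝ => Real.sin (c * t) * t ^ (-α)) (Set.Ioi 0) volume := by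
  have hm : Measurable (fun t : ℝ => Real.sin (c * t) * t ^ (-α)) := by fun_prop
  rw [← Set.Ioc_union_Ioi_eq_Ioi (zero_le_one' ℝ), integrableOn_union]
  constructor
  · have h1 : IntegrableOn (fun t : ℝ => |c| * t ^ (1 - α)) (Set.Ioc 0 1) volume := by
      rw [integrableOn_Ioc_iff_integrableOn_Ioo]
      exact ((intervalIntegral.integrableOn_Ioo_rpow_iff one_pos).2 (by linarith)).const_mul _
    refine Integrable.mono' h1 hm.aestronglyMeasurable ?_
    refine ae_restrict_of_forall_mem measurableSet_Ioc fun t ht => ?_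
    have ht0 : 0 < t := ht.1
    rw [norm_mul, Real.norm_eq_abs, Real.norm_of_nonneg (by positivity), sub_eq_add_neg,
      Real.rpow_add ht0, Real.rpow_one, ← mul_assoc]
    gcongr
    refine Real.abs_sin_le_abs.trans ?_
    rw [abs_mul, abs_of_pos ht0]
  · have h1 := integrableOn_Ioi_rpow_of_lt (a := -α) (by linarith) one_pos
    refine Integrable.mono' h1 hm.aestronglyMeasurable ?_
    refine ae_restrict_of_forall_mem measurableSet_Ioi fun t ht => ?_
    have ht0 : 0 < t := lt_trans one_pos ht
    rw [norm_mul, Real.norm_eq_abs, Real.norm_of_nonneg (by positivity)]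
    exact mul_le_of_le_one_left (by positivity) (Real.abs_sin_le_one _)

lemma aux_lap (x : ℝ) (hx : 0 < x) :
    ∫ t in Set.Ioi (0:ℝ), Real.sin t * Real.exp (-(t * x)) = 1 / (1 + x ^ 2) := by
  have hre : ((-x : ℝ) + Complex.I : ℂ).re < 0 := by simpa using hx
  have h := integral_exp_mul_complex_Ioi hre 0
  have hi := integrableOn_exp_mul_complex_Ioi hre 0
  have h2 := integral_im hi
  rw [h] at h2
  have e1 : ∀ t : ℝ, RCLike.im (Complex.exp (((-x : ℝ) + Complex.I : ℂ) * t))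
      = Real.sin t * Real.exp (-(t * x)) := by
    intro t
    simp [Complex.exp_im, mul_comm]
  simp_rw [e1] at h2
  rw [h2]
  simp [Complex.div_im, Complex.normSq_apply]
  field_simp
  ring

lemma aux_beta (α : ℝ) (hα1 : 1 < α) (hα2 : α < 2) :
    ∫ x in Set.Ioi (0:ℝ), x ^ (α - 1) * (1 / (1 + x ^ 2))
      = Real.Gamma (α / 2) * Real.Gamma (1 - α / 2) / 2 := by
  let F : ℝ → ℝ → ℝ := fun s x => x ^ (α - 1) * Real.exp (-(1 + x ^ 2) * s)
  have hFm : Measurable (Function.uncurry F) := by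
    unfold F Function.uncurry; fun_prop
  have key : ∀ s : ℝ, 0 < s → ∫ x in Set.Ioi (0:ℝ), F s x
      = Real.Gamma (α / 2) / 2 * (Real.exp (-s) * s ^ ((1 - α / 2) - 1)) := by
    intro s hs
    have h := integral_rpow_mul_exp_neg_mul_rpow (p := 2) (q := α - 1) two_pos (by linarith) hs
    have : ∀ x, F s x = Real.exp (-s) * (x ^ (α - 1) * Real.exp (-s * x ^ (2:ℝ))) := by
      intro x
      simp only [F]
      rw [mul_left_comm, ← Real.exp_add, Real.rpow_two]; ring_nf
    simp_rw [this]
    rw [integral_const_mul, h]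
    rw [show -(α - 1 + 1) / 2 = 1 - α / 2 - 1 by ring, show (α - 1 + 1) / 2 = α / 2 by ring]
    ring
  have hint : Integrable (Function.uncurry F)
      ((volume.restrict (Set.Ioi 0)).prod (volume.restrict (Set.Ioi 0))) := by
    rw [integrable_prod_iff hFm.aestronglyMeasurable]
    constructor
    · refine ae_restrict_of_forall_mem measurableSet_Ioi fun s hs => ?_
      have h := integrableOn_rpow_mul_exp_neg_mul_rpow (p := 2) (s := α - 1) (by linarith) two_pos hs
      refine (h.const_mul (Real.exp (-s))).congr (ae_of_all _ fun x => ?_)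
      simp only [F, Function.uncurry]
      rw [mul_left_comm, ← Real.exp_add, Real.rpow_two]; ring_nf
    · have h := (Real.GammaIntegral_convergent (s := 1 - α / 2) (by linarith)).const_mul
        (Real.Gamma (α / 2) / 2)
      refine h.congr (ae_restrict_of_forall_mem measurableSet_Ioi fun s hs => ?_)
      beta_reduce
      rw [← key s hs]
      refine setIntegral_congr_fun measurableSet_Ioi fun x hx => ?_
      have hx : 0 < x := hx
      simp only [F, Function.uncurry]
      rw [Real.norm_of_nonneg (by positivity)]
  have sw := integral_integral_swap hint
  have l : ∫ s in Set.Ioi (0:ℝ), ∫ x in Set.Ioi (0:ℝ), F s x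
      = Real.Gamma (α / 2) / 2 * Real.Gamma (1 - α / 2) := by
    rw [setIntegral_congr_fun measurableSet_Ioi (fun s hs => key s hs), integral_const_mul,
      ← Real.Gamma_eq_integral (by linarith)]
  have r : ∫ x in Set.Ioi (0:ℝ), ∫ s in Set.Ioi (0:ℝ), F s x
      = ∫ x in Set.Ioi (0:ℝ), x ^ (α - 1) * (1 / (1 + x ^ 2)) := by
    congr 1; ext x
    have hx : 0 < 1 + x ^ 2 := by positivity
    simp only [F]
    rw [integral_const_mul, integral_exp_mul_Ioi (by linarith), mul_zero, Real.exp_zero, neg_div_neg_eq]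
  rw [← r, ← sw, l]; ring

lemma aux_sin_one (α : ℝ) (hα1 : 1 < α) (hα2 : α < 2) :
    ∫ t in Set.Ioi (0:ℝ), Real.sin t * t ^ (-α)
      = Real.Gamma (1 - α) * Real.cos (α * π / 2) := by
  let F : ℝ → ℝ → ℝ := fun t x => Real.sin t * (x ^ (α - 1) * Real.exp (-(t * x)))
  have hFm : Measurable (Function.uncurry F) := by
    unfold F Function.uncurry; fun_prop
  have g : ∀ t : ℝ, 0 < t → ∫ x in Set.Ioi (0:ℝ), x ^ (α - 1) * Real.exp (-(t * x))
      = Real.Gamma α * t ^ (-α) := by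
    intro t ht
    rw [Real.integral_rpow_mul_exp_neg_mul_Ioi (by linarith) ht, one_div,
      Real.inv_rpow ht.le, Real.rpow_neg ht.le]
    ring
  have hint : Integrable (Function.uncurry F)
      ((volume.restrict (Set.Ioi 0)).prod (volume.restrict (Set.Ioi 0))) := by
    rw [integrable_prod_iff hFm.aestronglyMeasurable]
    constructor
    · refine ae_restrict_of_forall_mem measurableSet_Ioi fun t ht => ?_
      have h := integrableOn_rpow_mul_exp_neg_mul_rpow (p := 1) (s := α - 1) (by linarith) one_pos ht
      refine (h.const_mul (Real.sin t)).congr (ae_of_all _ fun x => ?_)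
      simp [F, Function.uncurry]
    · have h := ((aux_sin_int α 1 hα1 hα2).norm).const_mul (Real.Gamma α)
      refine h.congr (ae_restrict_of_forall_mem measurableSet_Ioi fun t ht => ?_)
      have ht0 : 0 < t := ht
      have : ∫ x in Set.Ioi (0:ℝ), ‖Function.uncurry F (t, x)‖
          = ∫ x in Set.Ioi (0:ℝ), |Real.sin t| * (x ^ (α - 1) * Real.exp (-(t * x))) := by
        refine setIntegral_congr_fun measurableSet_Ioi fun x hx => ?_
        have hx : 0 < x := hx
        simp only [F, Function.uncurry]
        rw [norm_mul, Real.norm_eq_abs, Real.norm_of_nonneg (by positivity)]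
      beta_reduce
      rw [this, integral_const_mul, g t ht0, norm_mul, Real.norm_eq_abs,
        Real.norm_of_nonneg (by positivity), one_mul]
      ring
  have sw := integral_integral_swap hint
  have l : ∫ t in Set.Ioi (0:ℝ), ∫ x in Set.Ioi (0:ℝ), F t x
      = Real.Gamma α * ∫ t in Set.Ioi (0:ℝ), Real.sin t * t ^ (-α) := by
    rw [← integral_const_mul]
    refine setIntegral_congr_fun measurableSet_Ioi fun t ht => ?_
    simp only [F]
    rw [integral_const_mul, g t ht]; ring
  have r : ∫ x in Set.Ioi (0:ℝ), ∫ t in Set.Ioi (0:ℝ), F t x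
      = ∫ x in Set.Ioi (0:ℝ), x ^ (α - 1) * (1 / (1 + x ^ 2)) := by
    refine setIntegral_congr_fun measurableSet_Ioi fun x hx => ?_
    simp only [F]
    rw [← aux_lap x hx, ← integral_const_mul]
    congr 1; ext t; ring
  rw [l, r, aux_beta α hα1 hα2] at sw
  have g1 := Real.Gamma_mul_Gamma_one_sub (α / 2)
  have g2 := Real.Gamma_mul_Gamma_one_sub α
  have hG : 0 < Real.Gamma α := Real.Gamma_pos_of_pos (by linarith)
  have hs : 0 < Real.sin (α * π / 2) :=
    Real.sin_pos_of_pos_of_lt_pi (by positivity) (by nlinarith [Real.pi_pos])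
  have hc : Real.cos (α * π / 2) < 0 :=
    Real.cos_neg_of_pi_div_two_lt_of_lt (by nlinarith [Real.pi_pos]) (by nlinarith [Real.pi_pos])
  rw [show π * (α / 2) = α * π / 2 by ring] at g1
  rw [show π * α = 2 * (α * π / 2) by ring, Real.sin_two_mul] at g2
  apply mul_left_cancel₀ hG.ne'
  rw [sw, g1, ← mul_assoc, g2]
  generalize Real.cos (α * π / 2) = C at *
  generalize Real.sin (α * π / 2) = S at *
  have := hc.ne
  field_simp

lemma aux_sin_pos (α c : ℝ) (hα1 : 1 < α) (hα2 : α < 2) (hc : 0 < c) :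
    ∫ t in Set.Ioi (0:ℝ), Real.sin (c * t) * t ^ (-α)
      = c ^ (α - 1) * (Real.Gamma (1 - α) * Real.cos (α * π / 2)) := by
  rw [← aux_sin_one α hα1 hα2]
  have h := integral_comp_mul_left_Ioi (fun t : ℝ => Real.sin t * t ^ (-α)) 0 hc
  rw [mul_zero, smul_eq_mul] at h
  have e : ∫ t in Set.Ioi (0:ℝ), Real.sin (c * t) * (c * t) ^ (-α)
      = c ^ (-α) * ∫ t in Set.Ioi (0:ℝ), Real.sin (c * t) * t ^ (-α) := by
    rw [← integral_const_mul]
    refine setIntegral_congr_fun measurableSet_Ioi fun t ht => ?_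
    rw [Real.mul_rpow hc.le (le_of_lt ht)]; ring
  rw [e] at h
  have hp : 0 < c ^ (-α) := by positivity
  apply mul_left_cancel₀ hp.ne'
  rw [h, ← mul_assoc, ← Real.rpow_add hc, show -α + (α - 1) = -1 by ring, Real.rpow_neg_one]

lemma aux_sin (α c : ℝ) (hα1 : 1 < α) (hα2 : α < 2) :
    ∫ t in Set.Ioi (0:ℝ), Real.sin (c * t) * t ^ (-α)
      = spow c (α - 1) * (Real.Gamma (1 - α) * Real.cos (α * π / 2)) := by
  unfold spow
  rcases lt_trichotomy c 0 with h | h | h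
  · have := aux_sin_pos α (-c) hα1 hα2 (by linarith)
    simp_rw [neg_mul, Real.sin_neg, neg_mul] at this
    rw [integral_neg] at this
    rw [Real.sign_of_neg h, abs_of_neg h]
    linarith
  · simp [h]
  · rw [aux_sin_pos α c hα1 hα2 h, Real.sign_of_pos h, abs_of_pos h, one_mul]

theorem stmt15 (α : ℝ) (hα1 : 1 < α) (hα2 : α < 2) (u v : ℝ) :
    IntegrableOn (fun t : ℝ =>
      Real.sin (u * t / 2) * Real.sin (v * t / 2) * Real.sin ((u + v) * t / 2) / t ^ α)
      (Set.Ioi 0) volume ∧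
    spow (u + v) (α - 1) - spow u (α - 1) - spow v (α - 1)
      = -(4 / (Real.Gamma (1 - α) * Real.cos (α * π / 2))) *
        ∫ t in Set.Ioi (0 : ℝ),
          Real.sin (u * t / 2) * Real.sin (v * t / 2) * Real.sin ((u + v) * t / 2) / t ^ α := by
  have e : ∀ t ∈ Set.Ioi (0:ℝ), (1 / 4 : ℝ) * (Real.sin (u * t) * t ^ (-α)
        + Real.sin (v * t) * t ^ (-α) - Real.sin ((u + v) * t) * t ^ (-α)) =
      Real.sin (u * t / 2) * Real.sin (v * t / 2) * Real.sin ((u + v) * t / 2) / t ^ α := by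
    intro t ht
    rw [Real.rpow_neg (le_of_lt ht)]
    have a1 : Real.sin (u * t) = 2 * Real.sin (u * t / 2) * Real.cos (u * t / 2) := by
      rw [← Real.sin_two_mul]; ring_nf
    have a2 : Real.sin (v * t) = 2 * Real.sin (v * t / 2) * Real.cos (v * t / 2) := by
      rw [← Real.sin_two_mul]; ring_nf
    have a3 : Real.sin ((u + v) * t) = Real.sin (u * t) * Real.cos (v * t)
        + Real.cos (u * t) * Real.sin (v * t) := by
      rw [← Real.sin_add]; ring_nf
    have a4 : Real.sin ((u + v) * t / 2) = Real.sin (u * t / 2) * Real.cos (v * t / 2)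
        + Real.cos (u * t / 2) * Real.sin (v * t / 2) := by
      rw [← Real.sin_add]; ring_nf
    have b1 : Real.cos (u * t) = 1 - 2 * Real.sin (u * t / 2) ^ 2 := by
      rw [← Real.cos_sq_add_sin_sq (u * t / 2), show u * t = 2 * (u * t / 2) by ring,
        Real.cos_two_mul']
      ring_nf
    have b2 : Real.cos (v * t) = 1 - 2 * Real.sin (v * t / 2) ^ 2 := by
      rw [← Real.cos_sq_add_sin_sq (v * t / 2), show v * t = 2 * (v * t / 2) by ring,
        Real.cos_two_mul']
      ring_nf
    rw [a3, a4, b1, b2, a1, a2]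
    ring
  have iu := aux_sin_int α u hα1 hα2
  have iv := aux_sin_int α v hα1 hα2
  have iw := aux_sin_int α (u + v) hα1 hα2
  refine ⟨IntegrableOn.congr_fun (((iu.add iv).sub iw).const_mul (1 / 4)) e measurableSet_Ioi, ?_⟩
  have iuv : IntegrableOn (fun t : ℝ => Real.sin (u * t) * t ^ (-α) + Real.sin (v * t) * t ^ (-α))
      (Set.Ioi 0) volume := iu.add iv
  rw [← setIntegral_congr_fun measurableSet_Ioi e, integral_const_mul,
    integral_sub iuv iw, integral_add iu iv, aux_sin α u hα1 hα2, aux_sin α v hα1 hα2,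
    aux_sin α (u + v) hα1 hα2]
  have hc : Real.cos (α * π / 2) < 0 :=
    Real.cos_neg_of_pi_div_two_lt_of_lt (by nlinarith [Real.pi_pos]) (by nlinarith [Real.pi_pos])
  have hs : 0 < Real.sin (α * π / 2) :=
    Real.sin_pos_of_pos_of_lt_pi (by positivity) (by nlinarith [Real.pi_pos])
  have hG : Real.Gamma (1 - α) ≠ 0 := by
    have g2 := Real.Gamma_mul_Gamma_one_sub α
    rw [show π * α = 2 * (α * π / 2) by ring, Real.sin_two_mul] at g2
    intro h0
    rw [h0, mul_zero] at g2
    have := hc.ne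
    exact absurd g2.symm (by positivity)
  generalize Real.cos (α * π / 2) = C at *
  have := hc.ne
  field_simp
  ring
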